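/- Let G be a finite simple graph, let u, v be adjacent vertices of G, and let w be any vertex of G. Then B_u ∩ B_v ⊆ B_w if and only if N[u] ∩ N[v] ⊆ N[w]. -/

import Mathlib

/-- A *maxclique* of a graph is an inclusion-maximal clique. -/
def SimpleGraph.IsMaxclique {V : Type*} (G : SimpleGraph V) (C : Set V) : Prop :=
  G.IsClique C ∧ ∀ D : Set V, G.IsClique D → C ⊆ D → D = C

/-- The *bundle* `B_v` of a vertex `v`: the set of all maxcliques containing `v`. -/
def SimpleGraph.bundle {V : Type*} (G : SimpleGraph V) (v : V) : Set (Set V) :=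
  {C | G.IsMaxclique C ∧ v ∈ C}

/-- The closed neighborhood `N[v]` of a vertex `v`. -/
def SimpleGraph.closedNbhd {V : Type*} (G : SimpleGraph V) (v : V) : Set V :=
  {u | u = v ∨ G.Adj u v}

theorem SimpleGraph.IsClique.exists_isMaxclique_superset {V : Type*} [Finite V]
    {G : SimpleGraph V} {C : Set V} (hC : G.IsClique C) :
    ∃ D, C ⊆ D ∧ G.IsMaxclique D := by
  obtain ⟨D, hCD, hD⟩ := Finite.exists_le_maximal (p := fun D : Set V => G.IsClique D) hC
  exact ⟨D, hCD, hD.prop, fun E hE hDE => (hD.eq_of_subset hE hDE).symm⟩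

theorem SimpleGraph.IsClique.subset_closedNbhd {V : Type*} {G : SimpleGraph V} {C : Set V}
    (hC : G.IsClique C) {v : V} (hv : v ∈ C) : C ⊆ G.closedNbhd v := fun _ hx =>
  or_iff_not_imp_left.2 fun hne => hC hx hv hne

theorem SimpleGraph.IsMaxclique.mem_of_subset_closedNbhd {V : Type*} {G : SimpleGraph V}
    {C : Set V} (hC : G.IsMaxclique C) {w : V} (h : C ⊆ G.closedNbhd w) : w ∈ C := by
  have hins : G.IsClique (insert w C) :=
    hC.1.insert fun x hx hne => ((h hx).resolve_left hne.symm).symm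
  rw [← hC.2 _ hins (Set.subset_insert w C)]
  exact Set.mem_insert w C

/-- For adjacent vertices `u, v` and any vertex `w`:
`B_u ∩ B_v ⊆ B_w` iff `N[u] ∩ N[v] ⊆ N[w]`. -/
theorem stmt7 {V : Type*} [Fintype V] (G : SimpleGraph V) (u v w : V) (huv : G.Adj u v) :
    G.bundle u ∩ G.bundle v ⊆ G.bundle w ↔
      G.closedNbhd u ∩ G.closedNbhd v ⊆ G.closedNbhd w := by
  constructor
  · rintro h x ⟨hxu, hxv⟩
    have hclique : G.IsClique {x, u, v} := by
      refine (SimpleGraph.isClique_pair.2 fun _ => huv).insert ?_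
      rintro y (rfl | rfl) hne
      · exact hxu.resolve_left hne
      · exact hxv.resolve_left hne
    obtain ⟨C, hsub, hC⟩ := hclique.exists_isMaxclique_superset
    have hw : C ∈ G.bundle w := h ⟨⟨hC, hsub (by simp)⟩, ⟨hC, hsub (by simp)⟩⟩
    exact hC.1.subset_closedNbhd hw.2 (hsub (by simp))
  · rintro h C ⟨⟨hC, hu⟩, ⟨-, hv⟩⟩
    exact ⟨hC, hC.mem_of_subset_closedNbhd fun x hx =>
      h ⟨hC.1.subset_closedNbhd hu hx, hC.1.subset_closedNbhd hv hx⟩⟩
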